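/- (Automation raises the return on capital in region 1) For every K > 0, L > 0 and Φ ∈ (0,1) with K/L > Φ/(1−Φ), the partial derivative of F_K(K,L;Φ) with respect to Φ is strictly positive. -/

import Mathlib

/-- Region-1 CES production function. -/
noncomputable def F (A σ K L Φ : ℝ) : ℝ :=
  A * (K ^ ((σ - 1) / σ) * Φ ^ (1 / σ) + L ^ ((σ - 1) / σ) * (1 - Φ) ^ (1 / σ)) ^ (σ / (σ - 1))

/-- Return to capital: partial derivative of `F` with respect to `K`. -/
noncomputable def FK (A σ K L Φ : ℝ) : ℝ := deriv (fun K' => F A σ K' L Φ) K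

/-- The argument of the outer power in `F` is positive on the economic domain. -/
lemma ces_aggregate_pos {K L Φ : ℝ} (r s : ℝ) (hK : 0 < K) (hL : 0 < L) (hΦ0 : 0 < Φ)
    (hΦ1 : Φ < 1) : 0 < K ^ r * Φ ^ s + L ^ r * (1 - Φ) ^ s := by
  have h : 0 < 1 - Φ := sub_pos.2 hΦ1
  positivity

/-- Closed form of the return to capital. -/
lemma FK_eq {σ K L Φ : ℝ} (A : ℝ) (hσ0 : 0 < σ) (hσ1 : σ < 1) (hK : 0 < K) (hL : 0 < L)
    (hΦ0 : 0 < Φ) (hΦ1 : Φ < 1) :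
    FK A σ K L Φ = A * K ^ ((σ - 1) / σ - 1) *
      ((K ^ ((σ - 1) / σ) * Φ ^ (1 / σ) + L ^ ((σ - 1) / σ) * (1 - Φ) ^ (1 / σ))
        ^ (σ / (σ - 1) - 1) * Φ ^ (1 / σ)) := by
  have hS := ces_aggregate_pos ((σ - 1) / σ) (1 / σ) hK hL hΦ0 hΦ1
  have hd := ((((Real.hasDerivAt_rpow_const (p := (σ - 1) / σ) (Or.inl hK.ne')).mul_const
    (Φ ^ (1 / σ))).add_const (L ^ ((σ - 1) / σ) * (1 - Φ) ^ (1 / σ))).rpow_const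
    (p := σ / (σ - 1)) (Or.inl hS.ne')).const_mul A
  have he : (σ - 1) / σ * (σ / (σ - 1)) = 1 := by
    have : σ - 1 ≠ 0 := by linarith
    field_simp
  refine hd.deriv.trans ?_
  linear_combination (A * K ^ ((σ - 1) / σ - 1) *
      ((K ^ ((σ - 1) / σ) * Φ ^ (1 / σ) + L ^ ((σ - 1) / σ) * (1 - Φ) ^ (1 / σ))
        ^ (σ / (σ - 1) - 1) * Φ ^ (1 / σ))) * he

/-- When labor is relatively scarce, the effective capital term is below the labor term. -/
lemma rpow_mul_rpow_lt_of_region {σ K L Φ : ℝ} (hσ0 : 0 < σ) (hσ1 : σ < 1) (hK : 0 < K)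
    (hL : 0 < L) (hΦ0 : 0 < Φ) (hΦ1 : Φ < 1) (hreg : Φ / (1 - Φ) < K / L) :
    K ^ ((σ - 1) / σ) * Φ ^ (1 / σ - 1) < L ^ ((σ - 1) / σ) * (1 - Φ) ^ (1 / σ - 1) := by
  have h1 : 0 < 1 - Φ := sub_pos.2 hΦ1
  have ht : 0 < 1 / σ - 1 := sub_pos.2 (one_lt_one_div hσ0 hσ1)
  have hr : (σ - 1) / σ = -(1 / σ - 1) := by field_simp; ring
  have key : Φ / K < (1 - Φ) / L := by
    rw [div_lt_div_iff₀ h1 hL] at hreg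
    rw [div_lt_div_iff₀ hK hL]
    linarith
  have := Real.rpow_lt_rpow (by positivity) key ht
  rw [Real.div_rpow hΦ0.le hK.le, Real.div_rpow h1.le hL.le] at this
  rw [hr, Real.rpow_neg hK.le, Real.rpow_neg hL.le]
  simpa only [div_eq_inv_mul] using this

theorem stmt7 (A σ K L Φ : ℝ) (hA : 0 < A) (hσ0 : 0 < σ) (hσ1 : σ < 1)
    (hK : 0 < K) (hL : 0 < L) (hΦ0 : 0 < Φ) (hΦ1 : Φ < 1)
    (hreg1 : K / L > Φ / (1 - Φ)) :
    0 < deriv (fun Φ' => FK A σ K L Φ') Φ := by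
  have h1 : 0 < 1 - Φ := sub_pos.2 hΦ1
  have hS := ces_aggregate_pos ((σ - 1) / σ) (1 / σ) hK hL hΦ0 hΦ1
  have hlt := rpow_mul_rpow_lt_of_region hσ0 hσ1 hK hL hΦ0 hΦ1 hreg1
  have hpow := Real.hasDerivAt_rpow_const (p := 1 / σ) (Or.inl hΦ0.ne')
  have hpow' := ((hasDerivAt_id Φ).const_sub 1).rpow_const (p := 1 / σ) (Or.inl h1.ne')
  have hd := ((((hpow.const_mul (K ^ ((σ - 1) / σ))).add
    (hpow'.const_mul (L ^ ((σ - 1) / σ)))).rpow_const (p := σ / (σ - 1) - 1)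
    (Or.inl hS.ne')).mul hpow).const_mul (A * K ^ ((σ - 1) / σ - 1))
  have heq : (fun Φ' => FK A σ K L Φ') =ᶠ[nhds Φ] _ :=
    Filter.eventually_of_mem (Ioo_mem_nhds hΦ0 hΦ1)
      fun x hx => FK_eq A hσ0 hσ1 hK hL hx.1 hx.2
  rw [heq.deriv_eq]
  refine lt_of_lt_of_eq ?_ hd.deriv.symm
  have he : σ / (σ - 1) - 1 < 0 := by
    have := div_neg_of_pos_of_neg hσ0 (sub_neg.2 hσ1)
    linarith
  have hS' : K ^ ((σ - 1) / σ) * (1 / σ * Φ ^ (1 / σ - 1)) +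
      L ^ ((σ - 1) / σ) * (-1 * (1 / σ) * (1 - Φ) ^ (1 / σ - 1)) < 0 := by
    have := mul_pos (one_div_pos.2 hσ0) (sub_pos.2 hlt)
    linarith
  have hprod := mul_pos_of_neg_of_neg hS' he
  refine mul_pos (by positivity) (add_pos (mul_pos (mul_pos hprod ?_) (by positivity)) ?_)
  · exact Real.rpow_pos_of_pos hS _
  · exact mul_pos (Real.rpow_pos_of_pos hS _) (by positivity)
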